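/- arXiv:2311.10634 — 6 statements merged into one kernel-verified Lean document; each statement's English description precedes it below -/
import Mathlib

section
/- Let (A,X) and (A',X') be conjunctive queries over the same signature τ that are #equivalent, and let G and G' be the Gaifman graphs of A and A' respectively. Then the induced subgraphs G[X] and G'[X'] are isomorphic as simple graphs. -/
/-- A relational structure over signature `σ` (with arities `ar`) whose elements
come from the ambient type `V`. -/
structure Struct (σ : Type) (ar : σ → ℕ) (V : Type) where
  univ : Set V
  rel : ∀ R : σ, Set (Fin (ar R) → V)
  mem_univ : ∀ R : σ, ∀ t ∈ rel R, ∀ i, t i ∈ univ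

/-- `h` is a homomorphism from `A` to `D`. -/
def IsHom {σ : Type} {ar : σ → ℕ} {V W : Type}
    (A : Struct σ ar V) (D : Struct σ ar W) (h : V → W) : Prop :=
  (∀ v ∈ A.univ, h v ∈ D.univ) ∧
  ∀ R : σ, ∀ t ∈ A.rel R, (fun i => h (t i)) ∈ D.rel R

/-- Answer set of the conjunctive query `(A, X)` in the database `D`. -/
def Ans {σ : Type} {ar : σ → ℕ} {V W : Type}
    (A : Struct σ ar V) (X : Set V) (D : Struct σ ar W) : Set (X → W) :=
  { a | ∃ h : V → W, IsHom A D h ∧ ∀ x : X, h (x : V) = a x }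

/-- #equivalence of conjunctive queries: equal numbers of answers in every database. -/
def CountEquiv {σ : Type} {ar : σ → ℕ} {V V' : Type}
    (A : Struct σ ar V) (X : Set V) (A' : Struct σ ar V') (X' : Set V') : Prop :=
  ∀ (W : Type) (D : Struct σ ar W), D.univ.Finite → D.univ.Nonempty →
    (Ans A X D).ncard = (Ans A' X' D).ncard

/-- The Gaifman graph of a structure: distinct `u, v` are adjacent iff some tuple
of some relation contains both. -/
def gaifman {σ : Type} {ar : σ → ℕ} {V : Type} (A : Struct σ ar V) :
    SimpleGraph V :=
  SimpleGraph.fromRel (fun u v =>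
    ∃ R, ∃ t ∈ A.rel R, (∃ i, t i = u) ∧ (∃ i, t i = v))

/-- The blow-up of `B` in which each element `v` is replaced by `n v + 1` copies. -/
def blowup {σ : Type} {ar : σ → ℕ} {V : Type} (B : Struct σ ar V) (n : V → ℕ) :
    Struct σ ar (V × ℕ) where
  univ := {p | p.1 ∈ B.univ ∧ p.2 < n p.1 + 1}
  rel R := {t | (fun i => (t i).1) ∈ B.rel R ∧ ∀ i, (t i).2 < n (t i).1 + 1}
  mem_univ R _ ht i := ⟨B.mem_univ R _ ht.1 i, ht.2 i⟩

theorem blowup_univ_finite {σ : Type} {ar : σ → ℕ} {V : Type} (B : Struct σ ar V)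
    (hB : B.univ.Finite) (n : V → ℕ) : (blowup B n).univ.Finite := by
  refine (hB.biUnion fun v _ => (Set.finite_lt_nat (n v + 1)).image (Prod.mk v)).subset ?_
  rintro ⟨v, i⟩ ⟨hv, hi⟩
  exact Set.mem_biUnion hv ⟨i, hi, rfl⟩

theorem mem_Ans_blowup {σ : Type} {ar : σ → ℕ} {V W : Type} (A : Struct σ ar V) {X : Set V}
    (hX : X ⊆ A.univ) (B : Struct σ ar W) (n : W → ℕ) (a : X → W × ℕ) :
    a ∈ Ans A X (blowup B n) ↔
      (fun x => (a x).1) ∈ Ans A X B ∧ ∀ x, (a x).2 < n (a x).1 + 1 := by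
  classical
  constructor
  · rintro ⟨h, ⟨hu, hr⟩, ha⟩
    refine ⟨⟨fun v => (h v).1, ⟨fun v hv => (hu v hv).1, fun R t ht => (hr R t ht).1⟩,
      fun x => by simp [ha]⟩, fun x => ?_⟩
    rw [← ha x]
    exact (hu x (hX x.2)).2
  · rintro ⟨⟨h, ⟨hu, hr⟩, ha⟩, hn⟩
    let k : V → W × ℕ := fun v => (h v, if hv : v ∈ X then (a ⟨v, hv⟩).2 else 0)
    have hk : ∀ v, (k v).2 < n (k v).1 + 1 := by
      intro v
      by_cases hv : v ∈ X
      · have := hn ⟨v, hv⟩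
        have h1 : h v = (a ⟨v, hv⟩).1 := ha ⟨v, hv⟩
        simpa [k, hv, h1] using this
      · simp [k, hv]
    refine ⟨k, ⟨fun v hv => ⟨hu v hv, hk v⟩, fun R t ht => ⟨hr R t ht, fun _ => hk _⟩⟩,
      fun x => Prod.ext (ha x) ?_⟩
    simp [k]

theorem Ans_finite {σ : Type} {ar : σ → ℕ} {V W : Type} (A : Struct σ ar V) {X : Set V}
    [Finite X] (hX : X ⊆ A.univ) (B : Struct σ ar W) (hB : B.univ.Finite) :
    (Ans A X B).Finite := by
  refine (Set.Finite.pi' fun _ : X => hB).subset ?_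
  rintro a ⟨h, hh, ha⟩ x
  rw [← ha x]
  exact hh.1 x (hX x.2)

theorem ncard_Ans_blowup {σ : Type} {ar : σ → ℕ} {V W : Type} (A : Struct σ ar V) {X : Set V}
    [Fintype X] (hX : X ⊆ A.univ) (B : Struct σ ar W) (hfin : (Ans A X B).Finite) (n : W → ℕ) :
    (Ans A X (blowup B n)).ncard = ∑ b ∈ hfin.toFinset, ∏ x, (n (b x) + 1) := by
  classical
  let S := hfin.toFinset.sigma fun b => Fintype.piFinset fun x => Finset.range (n (b x) + 1)
  have hS : S.card = ∑ b ∈ hfin.toFinset, ∏ x, (n (b x) + 1) := by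
    simp [S, Finset.card_sigma, Fintype.card_piFinset]
  rw [← hS, ← Set.ncard_coe_finset]
  symm
  refine Set.ncard_congr (fun p _ x => (p.1 x, p.2 x)) ?_ ?_ ?_
  · rintro ⟨b, f⟩ hp
    rw [mem_Ans_blowup A hX]
    simpa [S] using hp
  · rintro ⟨b, f⟩ ⟨c, g⟩ _ _ h
    have h1 : b = c := funext fun x => congrArg Prod.fst (congrFun h x)
    have h2 : f = g := funext fun x => congrArg Prod.snd (congrFun h x)
    rw [h1, h2]
  · intro a ha
    rw [mem_Ans_blowup A hX] at ha
    exact ⟨⟨fun x => (a x).1, fun x => (a x).2⟩, by simpa [S] using ha, rfl⟩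

/-- The polynomial whose values count the answers of `(A, X)` in the blow-ups of a structure
with answer set `S`. -/
noncomputable def ansPoly {X W : Type} [Fintype X] (S : Finset (X → W)) : MvPolynomial W ℤ :=
  ∑ b ∈ S, ∏ x, MvPolynomial.X (b x)

theorem coeff_ansPoly {X W : Type} [Fintype X] [DecidableEq W] (S : Finset (X → W)) (m : W →₀ ℕ) :
    (ansPoly S).coeff m = (S.filter fun b => ∑ x, Finsupp.single (b x) 1 = m).card := by
  have h (b : X → W) : (∏ x, MvPolynomial.X (b x) : MvPolynomial W ℤ) =
      MvPolynomial.monomial (∑ x, Finsupp.single (b x) 1) 1 := by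
    simp [MvPolynomial.X, MvPolynomial.monomial_sum_one]
  simp [ansPoly, MvPolynomial.coeff_sum, h, MvPolynomial.coeff_monomial, Finset.sum_boole]

theorem ansPoly_eq_of_eval {X X' W : Type} [Fintype X] [Fintype X']
    (S : Finset (X → W)) (S' : Finset (X' → W))
    (h : ∀ n : W → ℕ, ∑ b ∈ S, ∏ x, (n (b x) + 1) = ∑ b ∈ S', ∏ x, (n (b x) + 1)) :
    ansPoly S = ansPoly S' := by
  refine MvPolynomial.funext_set (fun _ => Set.range fun k : ℕ => (k : ℤ) + 1) (fun _ => ?_) ?_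
  · exact Set.infinite_range_of_injective fun a b hab => by simpa using hab
  · intro y hy
    choose n hn using fun v => hy v (Set.mem_univ v)
    have := congrArg (Nat.cast : ℕ → ℤ) (h n)
    push_cast at this
    simpa [ansPoly, ← hn] using this

/-- A #equivalence yields a homomorphism mapping the free variables onto the free variables. -/
theorem CountEquiv.exists_hom {σ : Type} {ar : σ → ℕ} {V V' : Type}
    {A : Struct σ ar V} {X : Set V} (hX : X ⊆ A.univ) (hAfin : A.univ.Finite)
    {A' : Struct σ ar V'} {X' : Set V'} (hX' : X' ⊆ A'.univ) (hA'fin : A'.univ.Finite)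
    (hne : A'.univ.Nonempty) (heq : CountEquiv A X A' X') :
    ∃ h : V → V', IsHom A A' h ∧ h '' X = X' := by
  classical
  have := (hAfin.subset hX).fintype
  have := (hA'fin.subset hX').fintype
  have hS := Ans_finite A hX A' hA'fin
  have hS' := Ans_finite A' hX' A' hA'fin
  have hP : ansPoly hS.toFinset = ansPoly hS'.toFinset := by
    refine ansPoly_eq_of_eval _ _ fun n => ?_
    rw [← ncard_Ans_blowup A hX, ← ncard_Ans_blowup A' hX']
    obtain ⟨v, hv⟩ := hne
    exact heq _ _ (blowup_univ_finite A' hA'fin n) ⟨(v, 0), hv, Nat.succ_pos _⟩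
  have hc := congrArg (MvPolynomial.coeff (∑ x : X', Finsupp.single (x : V') 1)) hP
  rw [coeff_ansPoly, coeff_ansPoly, Nat.cast_inj] at hc
  have hpos : 0 < (hS'.toFinset.filter fun b : X' → V' =>
      ∑ x, Finsupp.single (b x) 1 = ∑ x : X', Finsupp.single (x : V') 1).card :=
    Finset.card_pos.2 ⟨fun x => x, by
      simpa using ⟨id, ⟨fun _ h => h, fun _ _ h => h⟩, fun _ => rfl⟩⟩
  rw [← hc] at hpos
  obtain ⟨b, hb⟩ := Finset.card_pos.1 hpos
  rw [Finset.mem_filter, Set.Finite.mem_toFinset] at hb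
  obtain ⟨⟨h, hh, hb⟩, hm⟩ := hb
  refine ⟨h, hh, Set.ext fun v => ?_⟩
  have := DFunLike.congr_fun hm v
  simp only [← hb, Finsupp.finsetSum_apply, Finsupp.single_apply] at this
  have key : (∃ x : X, h x = v) ↔ ∃ x : X', (x : V') = v := by
    have := (congrArg (0 < ·) this)
    simpa [Finset.card_pos, Finset.Nonempty, -Subtype.exists] using this
  simpa using key

theorem CountEquiv.eq_empty {σ : Type} {ar : σ → ℕ} {V V' : Type}
    {A : Struct σ ar V} {X : Set V} (hX : X ⊆ A.univ) (hAfin : A.univ.Finite)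
    {A' : Struct σ ar V'} {X' : Set V'} (hX' : X' ⊆ A'.univ) (hA'fin : A'.univ.Finite)
    (heq : CountEquiv A X A' X') (h : X = ∅) : X' = ∅ := by
  by_contra hne
  obtain ⟨k, -, hk⟩ := heq.exists_hom hX hAfin hX' hA'fin
    ((Set.nonempty_iff_ne_empty.2 hne).mono hX')
  exact hne (by rw [← hk, h, Set.image_empty])

theorem IsHom.gaifman_adj {σ : Type} {ar : σ → ℕ} {V W : Type} {A : Struct σ ar V}
    {B : Struct σ ar W} {h : V → W} (hh : IsHom A B h) {u v : V} (huv : (gaifman A).Adj u v)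
    (hne : h u ≠ h v) : (gaifman B).Adj (h u) (h v) := by
  obtain ⟨-, ⟨R, t, ht, ⟨i, rfl⟩, ⟨j, rfl⟩⟩ | ⟨R, t, ht, ⟨i, rfl⟩, ⟨j, rfl⟩⟩⟩ := huv
  · exact ⟨hne, Or.inl ⟨R, _, hh.2 R t ht, ⟨i, rfl⟩, ⟨j, rfl⟩⟩⟩
  · exact ⟨hne, Or.inr ⟨R, _, hh.2 R t ht, ⟨i, rfl⟩, ⟨j, rfl⟩⟩⟩

/-- Finite graphs with injective homomorphisms in both directions are isomorphic. -/
theorem SimpleGraph.nonempty_iso_of_injective_homs {V W : Type} [Finite V]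
    {G : SimpleGraph V} {H : SimpleGraph W} (f : G →g H) (g : H →g G)
    (hf : Function.Bijective f) (hg : Function.Injective g) : Nonempty (G ≃g H) := by
  have hgf : Function.Injective (g ∘ f) := hg.comp hf.1
  let e : Equiv.Perm V := Equiv.ofBijective _ (Finite.injective_iff_bijective.1 hgf)
  obtain ⟨k, hk, hek⟩ := isOfFinOrder_iff_pow_eq_one.1 (isOfFinOrder_of_finite e)
  have he : ∀ j u v, G.Adj u v → G.Adj ((e ^ j) u) ((e ^ j) v) := by
    intro j
    induction j with
    | zero => simp
    | succ j ih =>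
      intro u v huv
      rw [pow_succ, Equiv.Perm.mul_apply, Equiv.Perm.mul_apply]
      exact ih _ _ (g.map_adj (f.map_adj huv))
  refine ⟨⟨Equiv.ofBijective f hf, fun {u v} => ⟨fun huv => ?_, fun huv => f.map_adj huv⟩⟩⟩
  obtain ⟨j, rfl⟩ := Nat.exists_eq_add_of_lt hk
  have := he j (e u) (e v) (g.map_adj huv)
  rw [← Equiv.Perm.mul_apply, ← Equiv.Perm.mul_apply, ← pow_succ] at this
  rw [zero_add] at hek
  simpa [hek] using this

/-- if `(A, X)` and `(A', X')` are #equivalent, then the induced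
subgraphs `G[X]` and `G'[X']` of their Gaifman graphs are isomorphic. -/
theorem stmt5 {σ : Type} {ar : σ → ℕ} {V V' : Type}
    (A : Struct σ ar V) (X : Set V) (hX : X ⊆ A.univ) (hAfin : A.univ.Finite)
    (A' : Struct σ ar V') (X' : Set V') (hX' : X' ⊆ A'.univ) (hA'fin : A'.univ.Finite)
    (heq : CountEquiv A X A' X') :
    Nonempty (SimpleGraph.induce X (gaifman A) ≃g SimpleGraph.induce X' (gaifman A')) := by
  have heq' : CountEquiv A' X' A X := fun W D hD hne => (heq W D hD hne).symm
  rcases X.eq_empty_or_nonempty with hE | hne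
  · have hE' := heq.eq_empty hX hAfin hX' hA'fin hE
    subst hE hE'
    exact ⟨⟨Equiv.equivOfIsEmpty _ _, fun {u} => u.2.elim⟩⟩
  have hne' : X'.Nonempty := Set.nonempty_iff_ne_empty.2 fun hE' =>
    hne.ne_empty (heq'.eq_empty hX' hA'fin hX hAfin hE')
  obtain ⟨h, hh, hhX⟩ := heq.exists_hom hX hAfin hX' hA'fin (hne'.mono hX')
  obtain ⟨k, hk, hkX⟩ := heq'.exists_hom hX' hA'fin hX hAfin (hne.mono hX)
  have := (hAfin.subset hX).to_subtype
  have := (hA'fin.subset hX').to_subtype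
  have hm : Set.MapsTo h X X' := Set.mapsTo_iff_image_subset.2 hhX.le
  have km : Set.MapsTo k X' X := Set.mapsTo_iff_image_subset.2 hkX.le
  have hs : Function.Surjective (hm.restrict h X X') :=
    (Set.MapsTo.restrict_surjective_iff hm).2 hhX.ge
  have ks : Function.Surjective (km.restrict k X' X) :=
    (Set.MapsTo.restrict_surjective_iff km).2 hkX.ge
  have hi : Function.Injective (hm.restrict h X X') :=
    ((Finite.surjective_iff_bijective.1 (ks.comp hs)).1).of_comp
  have ki : Function.Injective (km.restrict k X' X) :=
    ((Finite.surjective_iff_bijective.1 (hs.comp ks)).1).of_comp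
  exact SimpleGraph.nonempty_iso_of_injective_homs
    ⟨hm.restrict h X X', fun {u v} huv =>
      hh.gaifman_adj huv fun e => huv.ne (hi (Subtype.ext e))⟩
    ⟨km.restrict k X' X, fun {u v} huv =>
      hk.gaifman_adj huv fun e => huv.ne (ki (Subtype.ext e))⟩
    ⟨hi, hs⟩ ki
end

section
/- Let (A,X) be a self-join-free conjunctive query, i.e. every relation of A contains at most one tuple. Let A' be the structure obtained from A by deleting all isolated elements of U(A)∖X, that is, U(A') = X ∪ { v ∈ U(A) | v occurs in some tuple of some relation of A } and A' has the same relations as A. Then (A',X) is #equivalent to (A,X) and (A',X) is #minimal; that is, (A',X) is the #core of (A,X). -/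
/-- `A'` is a substructure of `A`. -/
def IsSubstruct {σ : Type} {ar : σ → ℕ} {V : Type}
    (A' A : Struct σ ar V) : Prop :=
  A'.univ ⊆ A.univ ∧ ∀ R, A'.rel R ⊆ A.rel R

/-- `(A, X)` is #minimal: no proper substructure containing `X` is #equivalent
to `(A, X)`. -/
def CMinimal {σ : Type} {ar : σ → ℕ} {V : Type}
    (A : Struct σ ar V) (X : Set V) : Prop :=
  ¬ ∃ A' : Struct σ ar V,
      IsSubstruct A' A ∧ A' ≠ A ∧ X ⊆ A'.univ ∧ CountEquiv A' X A X

/-- The structure obtained from `A` by deleting all isolated elements outside `X`: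
its universe is `X` together with all elements occurring in some tuple of some
relation of `A`, and it has the same relations as `A`. -/
def delIsolated {σ : Type} {ar : σ → ℕ} {V : Type}
    (A : Struct σ ar V) (X : Set V) : Struct σ ar V where
  univ := X ∪ { v | ∃ R, ∃ t ∈ A.rel R, ∃ i, t i = v }
  rel := A.rel
  mem_univ := fun R t ht i => Or.inr ⟨R, t, ht, i, rfl⟩

theorem ans_delIsolated {σ : Type} {ar : σ → ℕ} {V W : Type} (A : Struct σ ar V) {X : Set V}
    (hX : X ⊆ A.univ) (D : Struct σ ar W) (hD : D.univ.Nonempty) :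
    Ans (delIsolated A X) X D = Ans A X D := by
  classical
  obtain ⟨d, hd⟩ := hD
  ext a
  constructor
  · rintro ⟨h, ⟨hu, hr⟩, ha⟩
    refine ⟨fun v => if v ∈ (delIsolated A X).univ then h v else d, ⟨fun v _ => ?_, ?_⟩, ?_⟩
    · dsimp only
      split_ifs with hv
      exacts [hu v hv, hd]
    · intro R t ht
      have hmem : ∀ i, t i ∈ (delIsolated A X).univ := (delIsolated A X).mem_univ R t ht
      simpa only [hmem, if_true] using hr R t ht
    · intro x
      have hx : (x : V) ∈ (delIsolated A X).univ := Or.inl x.2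
      simpa only [hx, if_true] using ha x
  · rintro ⟨h, ⟨hu, hr⟩, ha⟩
    refine ⟨h, ⟨?_, hr⟩, ha⟩
    rintro v (hv | ⟨R, t, ht, i, rfl⟩)
    exacts [hu v (hX hv), hu _ (A.mem_univ R t ht i)]

/-- The one-element structure in which exactly the relations of `S` hold. -/
def pointStruct {σ : Type} (ar : σ → ℕ) (S : Set σ) : Struct σ ar Unit where
  univ := Set.univ
  rel := fun R => { _t | R ∈ S }
  mem_univ := fun _ _ _ _ => Set.mem_univ _

theorem ans_pointStruct_nonempty_iff {σ : Type} {ar : σ → ℕ} {V : Type} (A : Struct σ ar V)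
    (X : Set V) (S : Set σ) :
    (Ans A X (pointStruct ar S)).Nonempty ↔ ∀ R, (A.rel R).Nonempty → R ∈ S :=
  ⟨fun ⟨_, _, ⟨_, hr⟩, _⟩ R ⟨t, ht⟩ => hr R t ht,
    fun hS => ⟨fun _ => (), fun _ => (), ⟨fun _ _ => Set.mem_univ _,
      fun R t ht => hS R ⟨t, ht⟩⟩, fun _ => rfl⟩⟩

/-- #equivalent queries use the same relation symbols. -/
theorem CountEquiv.rel_nonempty {σ : Type} {ar : σ → ℕ} {V V' : Type}
    {A : Struct σ ar V} {X : Set V} {A' : Struct σ ar V'} {X' : Set V'}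
    (h : CountEquiv A X A' X') {R : σ} (hR : (A'.rel R).Nonempty) : (A.rel R).Nonempty := by
  let S : Set σ := { Q | (A.rel Q).Nonempty }
  have hA : (Ans A X (pointStruct ar S)).Nonempty :=
    (ans_pointStruct_nonempty_iff A X S).2 fun _ hQ => hQ
  have hcard := h Unit (pointStruct ar S) Set.finite_univ Set.univ_nonempty
  rw [(Set.ncard_eq_one.2 (Set.exists_eq_singleton_iff_nonempty_subsingleton.2
    ⟨hA, Set.subsingleton_of_subsingleton⟩))] at hcard
  exact (ans_pointStruct_nonempty_iff A' X' S).1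
    (Set.nonempty_of_ncard_ne_zero (hcard ▸ one_ne_zero)) R hR

theorem Struct.eq_of_univ_of_rel {σ : Type} {ar : σ → ℕ} {V : Type} {A B : Struct σ ar V}
    (hu : A.univ = B.univ) (hr : ∀ R, A.rel R = B.rel R) : A = B := by
  cases A
  cases B
  obtain rfl := hu
  obtain rfl := funext hr
  rfl

/-- for a self-join-free conjunctive query `(A, X)` (every relation
has at most one tuple), deleting the isolated elements of `U(A) ∖ X` yields a
query `(A', X)` that is #equivalent to `(A, X)` and #minimal, i.e. the #core of
`(A, X)`. -/
theorem stmt6 {σ : Type} {ar : σ → ℕ} {V : Type}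
    (A : Struct σ ar V) (X : Set V) (hX : X ⊆ A.univ) (hAfin : A.univ.Finite)
    (hsjf : ∀ R, (A.rel R).Subsingleton) :
    CountEquiv (delIsolated A X) X A X ∧ CMinimal (delIsolated A X) X := by
  refine ⟨fun W D _ hD => by rw [ans_delIsolated A hX D hD], ?_⟩
  rintro ⟨B, ⟨hBu, hBr⟩, hne, hXB, hcount⟩
  have hrel : ∀ R, B.rel R = A.rel R := fun R => by
    refine (hBr R).antisymm fun t ht => ?_
    obtain ⟨s, hs⟩ := hcount.rel_nonempty (R := R) ⟨t, ht⟩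
    exact hsjf R (hBr R hs) ht ▸ hs
  refine hne (Struct.eq_of_univ_of_rel (hBu.antisymm ?_) hrel)
  rintro v (hv | ⟨R, t, ht, i, rfl⟩)
  exacts [hXB hv, B.mem_univ R t ((hrel R).symm ▸ ht) i]
end

section
/- Let Δ = (Ω,I) be an abstract simplicial complex and let x,y ∈ Ω be distinct such that x dominates y. Then Σ_{S ∈ I, y ∈ S} (−1)^{|S|} = 0. -/
/-- An abstract simplicial complex: a nonempty finite ground set together with a
downward-closed family of faces containing every singleton of the ground set. -/
structure Cpx (α : Type) [DecidableEq α] where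
  ground : Finset α
  ground_nonempty : ground.Nonempty
  faces : Finset (Finset α)
  subset_ground : ∀ S ∈ faces, S ⊆ ground
  down_closed : ∀ S ∈ faces, ∀ S' ⊆ S, S' ∈ faces
  singleton_mem : ∀ x ∈ ground, {x} ∈ faces

/-- `x` dominates `y`: every face containing `y` stays a face after inserting `x`. -/
def Dominates {α : Type} [DecidableEq α] (Δ : Cpx α) (x y : α) : Prop :=
  ∀ S ∈ Δ.faces, y ∈ S → insert x S ∈ Δ.faces

/-- if `x ≠ y` and `x` dominates `y`, then
`Σ_{S ∈ I, y ∈ S} (−1)^{|S|} = 0`. -/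
theorem stmt9 {α : Type} [DecidableEq α] (Δ : Cpx α) (x y : α)
    (hx : x ∈ Δ.ground) (hy : y ∈ Δ.ground) (hxy : x ≠ y)
    (hdom : Dominates Δ x y) :
    ∑ S ∈ Δ.faces.filter (fun S => y ∈ S), (-1 : ℤ) ^ S.card = 0 := by
  refine Finset.sum_involution (fun S _ => if x ∈ S then S.erase x else insert x S) ?_ ?_ ?_ ?_
  · intro S _
    by_cases h : x ∈ S
    · rw [if_pos h, ← Finset.card_erase_add_one h, pow_succ]
      ring
    · rw [if_neg h, Finset.card_insert_of_notMem h, pow_succ]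
      ring
  · intro S _ _ heq
    by_cases h : x ∈ S
    · rw [if_pos h] at heq
      exact Finset.notMem_erase x S (heq.symm ▸ h)
    · rw [if_neg h] at heq
      exact h (heq ▸ Finset.mem_insert_self x S)
  · intro S hS
    obtain ⟨hF, hyS⟩ := Finset.mem_filter.mp hS
    by_cases h : x ∈ S
    · simpa [h, hyS, hxy.symm] using Δ.down_closed S hF _ (Finset.erase_subset x S)
    · simpa [h, hyS] using hdom S hF hyS
  · intro S _
    by_cases h : x ∈ S
    · simp [h, Finset.insert_erase]
    · simp [h]
end

section
/- Let Δ = (Ω,I) be an abstract simplicial complex and suppose y ∈ Ω is dominated by some x ∈ Ω∖{y}. Then χ̂(Δ) = χ̂(Δ∖y), where Δ∖y is the abstract simplicial complex with ground set Ω∖{y} and face family { S ∈ I : y ∉ S }. -/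
/-- The reduced Euler characteristic `χ̂(Δ) = −Σ_{S ∈ I} (−1)^{|S|}`. -/
def chiHat {α : Type} [DecidableEq α] (Δ : Cpx α) : ℤ :=
  - ∑ S ∈ Δ.faces, (-1 : ℤ) ^ S.card

/-- If `x` dominates `y`, the signed count of the faces containing `y` vanishes: toggling `x` is a
sign-reversing involution on these faces. -/
theorem Dominates.sum_faces_containing_eq_zero {α : Type} [DecidableEq α] {Δ : Cpx α} {x y : α}
    (hxy : x ≠ y) (hdom : Dominates Δ x y) :
    ∑ S ∈ Δ.faces with y ∈ S, (-1 : ℤ) ^ S.card = 0 := by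
  refine Finset.sum_involution (fun S _ => if x ∈ S then S.erase x else insert x S) ?_ ?_ ?_ ?_
  · intro S _
    by_cases hx : x ∈ S
    · simp only [hx, if_true]
      rw [← Finset.card_erase_add_one hx, pow_succ]
      ring
    · simp only [hx, if_false]
      rw [Finset.card_insert_of_notMem hx, pow_succ]
      ring
  · intro S _ _ h
    by_cases hx : x ∈ S
    · simp [hx] at h
    · simp [hx] at h
  · intro S hS
    obtain ⟨hS, hyS⟩ := Finset.mem_filter.mp hS
    refine Finset.mem_filter.mpr ?_
    by_cases hx : x ∈ S
    · simp only [hx, if_true]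
      exact ⟨Δ.down_closed S hS _ (Finset.erase_subset x S),
        Finset.mem_erase.mpr ⟨hxy.symm, hyS⟩⟩
    · simp only [hx, if_false]
      exact ⟨hdom S hS hyS, Finset.mem_insert_of_mem hyS⟩
  · intro S _
    by_cases hx : x ∈ S
    · simp [hx]
    · simp [hx]

/-- if `y ∈ Ω` is dominated by some `x ∈ Ω ∖ {y}`, then
`χ̂(Δ) = χ̂(Δ ∖ y)`, where `Δ ∖ y` is the complex with ground set `Ω ∖ {y}` and
faces `{S ∈ I : y ∉ S}`. -/
theorem stmt10 {α : Type} [DecidableEq α] (Δ : Cpx α) (y : α)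
    (hy : y ∈ Δ.ground)
    (hdom : ∃ x ∈ Δ.ground, x ≠ y ∧ Dominates Δ x y)
    (Δ' : Cpx α)
    (hground : Δ'.ground = Δ.ground.erase y)
    (hfaces : Δ'.faces = Δ.faces.filter (fun S => y ∉ S)) :
    chiHat Δ = chiHat Δ' := by
  obtain ⟨x, -, hxy, hx⟩ := hdom
  rw [chiHat, chiHat, hfaces, ← Finset.sum_filter_add_sum_filter_not Δ.faces (fun S => y ∈ S),
    hx.sum_faces_containing_eq_zero hxy, zero_add]
end

section
/- Let Δ = (Ω,I) be an irreducible abstract simplicial complex with facets F_1,…,F_k. Then the map b : Ω → 2^{[k]} defined by b(x) = { i ∈ [k] : x ∉ F_i } is injective, and b(x) ≠ [k] for every x ∈ Ω. -/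
/-- A facet: an inclusion-maximal face. -/
def IsFacet {α : Type} [DecidableEq α] (Δ : Cpx α) (F : Finset α) : Prop :=
  F ∈ Δ.faces ∧ ∀ S ∈ Δ.faces, F ⊆ S → S = F

/-- A complex is irreducible if no element of the ground set is dominated by a
different element of the ground set. -/
def IrreducibleCpx {α : Type} [DecidableEq α] (Δ : Cpx α) : Prop :=
  ∀ x ∈ Δ.ground, ∀ y ∈ Δ.ground, x ≠ y → ¬ Dominates Δ x y

/-- Every face of a complex is contained in a facet. -/
theorem exists_isFacet_superset {α : Type} [DecidableEq α] (Δ : Cpx α) {S : Finset α}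
    (hS : S ∈ Δ.faces) : ∃ G, IsFacet Δ G ∧ S ⊆ G := by
  obtain ⟨G, hSG, hG⟩ := Δ.faces.exists_le_maximal hS
  exact ⟨G, ⟨hG.prop, fun T hT hGT => (hG.eq_of_le hT hGT).symm⟩, hSG⟩

/-- An element lying in every facet that contains `y` dominates `y`. -/
theorem dominates_of_forall_isFacet {α : Type} [DecidableEq α] (Δ : Cpx α) {x y : α}
    (h : ∀ G, IsFacet Δ G → y ∈ G → x ∈ G) : Dominates Δ x y := by
  intro S hS hy
  obtain ⟨G, hG, hSG⟩ := exists_isFacet_superset Δ hS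
  exact Δ.down_closed G hG.1 _ (Finset.insert_subset (h G hG (hSG hy)) hSG)

/-- for an irreducible complex with facets `F_1, …, F_k`, the map
`b(x) = { i ∈ [k] : x ∉ F_i }` is injective on the ground set, and `b(x) ≠ [k]`
for every `x` in the ground set. -/
theorem stmt12 {α : Type} [DecidableEq α] (Δ : Cpx α)
    (hirr : IrreducibleCpx Δ) (k : ℕ) (F : Fin k → Finset α)
    (hfacet : ∀ i, IsFacet Δ (F i))
    (hall : ∀ G : Finset α, IsFacet Δ G → ∃ i, F i = G)
    (hinj : Function.Injective F) :
    Set.InjOn (fun x => Finset.univ.filter (fun i => x ∉ F i)) ↑Δ.ground ∧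
    ∀ x ∈ Δ.ground, Finset.univ.filter (fun i : Fin k => x ∉ F i) ≠ Finset.univ := by
  refine ⟨fun x hx y hy hxy => ?_, fun x hx h => ?_⟩
  · by_contra hne
    refine hirr x hx y hy hne (dominates_of_forall_isFacet Δ fun G hG hyG => ?_)
    obtain ⟨i, rfl⟩ := hall G hG
    have hi := Finset.ext_iff.mp hxy i
    simp only [Finset.mem_filter, Finset.mem_univ, true_and] at hi
    exact not_not.mp fun hxG => hi.mp hxG hyG
  · obtain ⟨G, hG, hxG⟩ := exists_isFacet_superset Δ (Δ.singleton_mem x hx)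
    obtain ⟨i, rfl⟩ := hall G hG
    exact Finset.filter_eq_self.mp h i (Finset.mem_univ i) (Finset.singleton_subset_iff.mp hxG)
end

section
/- Let Δ = (Ω,I) be a non-trivial irreducible abstract simplicial complex. Then there exist a finite set 𝒰, a family Ω̂ ⊆ 2^𝒰 with 𝒰 ∉ Ω̂, and a bijection b : Ω → Ω̂ such that for every subset S ⊆ Ω: S ∈ I if and only if ⋃_{x∈S} b(x) ≠ 𝒰. In other words, Δ is isomorphic to the power complex Δ_{Ω̂,𝒰}. -/
/-- every non-trivial irreducible complex `Δ = (Ω, I)` is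
isomorphic to a power complex: there are a finite set `𝒰`, a family
`Ω̂ ⊆ 2^𝒰` with `𝒰 ∉ Ω̂`, and a bijection `b : Ω → Ω̂` such that for all
`S ⊆ Ω`, `S ∈ I` iff `⋃_{x ∈ S} b(x) ≠ 𝒰`. -/
theorem stmt13 {α : Type} [DecidableEq α] (Δ : Cpx α)
    (hirr : IrreducibleCpx Δ) (hnontrivial : Δ.ground.card ≠ 1) :
    ∃ (U : Finset ℕ) (Ohat : Finset (Finset ℕ)) (b : α → Finset ℕ),
      (∀ A ∈ Ohat, A ⊆ U) ∧ U ∉ Ohat ∧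
      (∀ x ∈ Δ.ground, b x ∈ Ohat) ∧
      Set.InjOn b ↑Δ.ground ∧
      (∀ A ∈ Ohat, ∃ x ∈ Δ.ground, b x = A) ∧
      (∀ S ⊆ Δ.ground, (S ∈ Δ.faces ↔ S.biUnion b ≠ U)) := by
  classical
  obtain ⟨e, he⟩ := Set.countable_iff_exists_injOn.mp Δ.faces.countable_toSet
  -- `b x` encodes the faces avoiding `x`, so a union omits exactly the faces containing `S`.
  let b : α → Finset ℕ := fun x => (Δ.faces.filter (fun F => x ∉ F)).image e
  have mem_b : ∀ x, ∀ F ∈ Δ.faces, (e F ∈ b x ↔ x ∉ F) := by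
    intro x F hF
    simp only [b, Finset.mem_image, Finset.mem_filter]
    constructor
    · rintro ⟨G, ⟨hG, hx⟩, hGF⟩
      rwa [← he hG hF hGF]
    · exact fun hx => ⟨F, ⟨hF, hx⟩, rfl⟩
  have b_subset : ∀ x, b x ⊆ Δ.faces.image e := fun x =>
    Finset.image_subset_image (Finset.filter_subset _ _)
  have face_iff : ∀ S : Finset α, S ∈ Δ.faces ↔ S.biUnion b ≠ Δ.faces.image e := by
    intro S
    constructor
    · intro hS h
      have hmem : e S ∈ S.biUnion b := h ▸ Finset.mem_image_of_mem e hS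
      obtain ⟨x, hx, hxb⟩ := Finset.mem_biUnion.mp hmem
      exact (mem_b x S hS).mp hxb hx
    · contrapose!
      intro hS
      refine (Finset.biUnion_subset.mpr fun x _ => b_subset x).antisymm ?_
      intro n hn
      obtain ⟨F, hF, rfl⟩ := Finset.mem_image.mp hn
      obtain ⟨x, hxS, hxF⟩ := Finset.not_subset.mp fun h => hS (Δ.down_closed F hF S h)
      exact Finset.mem_biUnion.mpr ⟨x, hxS, (mem_b x F hF).mpr hxF⟩
  refine ⟨Δ.faces.image e, Δ.ground.image b, b, ?_, ?_,
    fun x hx => Finset.mem_image_of_mem b hx, ?_,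
    fun A hA => Finset.mem_image.mp hA, fun S _ => face_iff S⟩
  · intro A hA
    obtain ⟨x, -, rfl⟩ := Finset.mem_image.mp hA
    exact b_subset x
  · intro h
    obtain ⟨x, hx, hxU⟩ := Finset.mem_image.mp h
    exact (face_iff {x}).mp (Δ.singleton_mem x hx) (by rw [Finset.singleton_biUnion, hxU])
  · intro x hx y _ hxy
    have hxF := Δ.singleton_mem x hx
    have h := mem_b y {x} hxF
    rw [← hxy, mem_b x {x} hxF] at h
    by_contra hne
    exact h.mpr (fun hy => hne (Finset.mem_singleton.mp hy).symm) (Finset.mem_singleton_self x)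
end
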